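/- Let d ≥ 2 and let π be a probability measure on ℝ^d with a positive density. Then the star-structured variational inference problem satisfies the dynamic programming identity: inf over μ ∈ C_star of KL(μ ‖ π) equals inf over μ₁ ∈ P(ℝ) of [ KL(μ₁ ‖ π₁) + ∫ ( inf over ν ∈ P(ℝ)^{⊗(d−1)} of KL(ν ‖ π_{−1}(· ∣ z₁)) ) μ₁(dz₁) ], where π₁ is the first marginal of π and π_{−1}(· ∣ z₁) is the conditional distribution of the last d−1 coordinates given the first coordinate z₁. -/

import Mathlib

open MeasureTheory ProbabilityTheory
open scoped ENNReal ProbabilityTheory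

open Classical in
/-- Kullback–Leibler divergence: `∫ log (dμ/dπ) dμ` if `μ ≪ π` (and the integral is
well-defined), and `+∞` otherwise. -/
noncomputable def KL {E : Type*} [MeasurableSpace E] (μ π : Measure E) : ℝ≥0∞ :=
  if μ ≪ π ∧ Integrable (fun z => Real.log (μ.rnDeriv π z).toReal) μ then
    ENNReal.ofReal (∫ z, Real.log (μ.rnDeriv π z).toReal ∂μ)
  else ⊤

/-- The star-structured measure on `ℝ × ℝ^k` with root marginal `μ₁` and leaf
conditional kernels `κ j`, i.e. `μ₁(dz₁) ∏_j κ_j(dz_j ∣ z₁)`. -/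
noncomputable def starMeasure {k : ℕ} (μ₁ : Measure ℝ) (κ : Fin k → Kernel ℝ ℝ) :
    Measure (ℝ × (Fin k → ℝ)) :=
  μ₁.bind fun z₁ => (Measure.dirac z₁).prod (Measure.pi fun j => κ j z₁)

/-- `μ ∈ C_star`: the leaf coordinates are conditionally independent given the root. -/
def IsStar {k : ℕ} (μ : Measure (ℝ × (Fin k → ℝ))) : Prop :=
  IsProbabilityMeasure μ ∧
    ∃ (μ₁ : Measure ℝ) (κ : Fin k → Kernel ℝ ℝ),
      IsProbabilityMeasure μ₁ ∧ (∀ j, IsMarkovKernel (κ j)) ∧ μ = starMeasure μ₁ κ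

/-- `ν ∈ P(ℝ)^{⊗ k}`: product probability measures on `ℝ^k`. -/
def IsProductProb {k : ℕ} (ν : Measure (Fin k → ℝ)) : Prop :=
  ∃ m : Fin k → Measure ℝ, (∀ j, IsProbabilityMeasure (m j)) ∧ ν = Measure.pi m

/-- The value of the inner mean-field variational problem with target `τ`. -/
noncomputable def hval {k : ℕ} (τ : Measure (Fin k → ℝ)) : ℝ≥0∞ :=
  ⨅ (ν : Measure (Fin k → ℝ)) (_ : IsProductProb ν), KL ν τ

/-- A set-valued map whose values are the common zero-sublevel sets of countably many functions
that are measurable in the parameter and continuous in the variable. -/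
def IsCaratheodorySublevel {Z K : Type*} [MeasurableSpace Z] [TopologicalSpace K]
    (A : Z → Set K) : Prop :=
  ∃ G : ℕ → Z → K → ℝ, (∀ n m, Measurable fun z => G n z m) ∧ (∀ n z, Continuous (G n z)) ∧
    ∀ z, A z = {m | ∀ n, G n z m ≤ 0}

namespace IsCaratheodorySublevel

variable {Z K : Type*} [MeasurableSpace Z] [TopologicalSpace K] {A : Z → Set K}

lemma isClosed (hA : IsCaratheodorySublevel A) (z : Z) : IsClosed (A z) := by
  obtain ⟨G, -, hc, hA⟩ := hA
  rw [hA, Set.ofPred_forall]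
  exact isClosed_iInter fun n => isClosed_le (hc n z) continuous_const

lemma inter (hA : IsCaratheodorySublevel A) {g : Z → K → ℝ}
    (hg : ∀ m, Measurable fun z => g z m) (hgc : ∀ z, Continuous (g z)) :
    IsCaratheodorySublevel fun z => A z ∩ {m | g z m ≤ 0} := by
  obtain ⟨G, hm, hc, hA⟩ := hA
  refine ⟨fun n => n.casesOn g G, ?_, ?_, fun z => ?_⟩
  · rintro (_ | n) m
    exacts [hg m, hm n m]
  · rintro (_ | n) z
    exacts [hgc z, hc n z]
  · ext m
    simp only [hA, Set.mem_inter_iff, Set.mem_ofPred_eq]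
    refine ⟨fun h n => ?_, fun h => ⟨fun n => h (n + 1), h 0⟩⟩
    cases n with
    | zero => exact h.2
    | succ n => exact h.1 n

lemma measurableSet_nonempty [CompactSpace K] [TopologicalSpace.SeparableSpace K]
    (hA : IsCaratheodorySublevel A) : MeasurableSet {z | (A z).Nonempty} := by
  obtain ⟨G, hm, hc, hA⟩ := hA
  cases isEmpty_or_nonempty K
  · simp [Set.eq_empty_of_isEmpty]
  have key : {z | (A z).Nonempty} = ⋂ N : ℕ, ⋃ i : ℕ, ⋂ n ∈ Set.Iic N,
      {z | G n z (TopologicalSpace.denseSeq K i) < 1 / ((N : ℝ) + 1)} := by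
    ext z
    simp only [Set.mem_ofPred_eq, Set.mem_iInter, Set.mem_iUnion, Set.mem_Iic, hA]
    constructor
    · rintro ⟨m, h⟩ N
      have ho : IsOpen {m | ∀ n ∈ Set.Iic N, G n z m < 1 / ((N : ℝ) + 1)} := by
        simp only [Set.ofPred_forall]
        exact (Set.finite_Iic N).isOpen_biInter fun n _ =>
          isOpen_lt (hc n z) continuous_const
      obtain ⟨x, hx, i, rfl⟩ := (TopologicalSpace.denseRange_denseSeq K).inter_open_nonempty _ ho
        ⟨m, fun n _ => (h n).trans_lt (by positivity)⟩
      exact ⟨i, hx⟩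
    · intro h
      obtain ⟨m, hmem⟩ := IsCompact.nonempty_iInter_of_sequence_nonempty_isCompact_isClosed
        (fun N : ℕ => {m | ∀ n ≤ N, G n z m ≤ 1 / ((N : ℝ) + 1)})
        (fun N m hmN n hn => (hmN n (hn.trans N.le_succ)).trans
          (one_div_le_one_div_of_le (by positivity) (by push_cast; linarith)))
        (fun N => let ⟨_, hi⟩ := h N; ⟨_, fun n hn => (hi n hn).le⟩)
        (IsClosed.isCompact (by
          simp only [Set.ofPred_forall]
          exact isClosed_iInter fun n => isClosed_iInter fun _ =>
            isClosed_le (hc n z) continuous_const))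
        (fun N => by
          simp only [Set.ofPred_forall]
          exact isClosed_iInter fun n => isClosed_iInter fun _ =>
            isClosed_le (hc n z) continuous_const)
      simp only [Set.mem_iInter, Set.mem_ofPred_eq] at hmem
      refine ⟨m, fun n => le_of_forall_pos_le_add fun ε hε => ?_⟩
      obtain ⟨N, hN⟩ := exists_nat_one_div_lt hε
      rw [zero_add]
      refine (hmem (max n N) n (le_max_left _ _)).trans (le_trans ?_ hN.le)
      exact one_div_le_one_div_of_le (by positivity) (by gcongr; exact le_max_right _ _)
  rw [key]
  exact .iInter fun N => .iUnion fun i => .biInter (Set.to_countable _) fun n _ =>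
    measurableSet_lt (hm n _) measurable_const

section Selection

variable [CompactSpace K]

lemma exists_isMinOn (hA : IsCaratheodorySublevel A) {z : Z} (hne : (A z).Nonempty)
    {g : K → ℝ} (hg : Continuous g) : ∃ m ∈ A z, g m = sInf (g '' A z) := by
  have hc := ((hA.isClosed z).isCompact.image hg)
  obtain ⟨m, hm, h⟩ := hc.sInf_mem (hne.image g)
  exact ⟨m, hm, h⟩

lemma measurable_sInf [TopologicalSpace.SeparableSpace K] (hA : IsCaratheodorySublevel A)
    (hne : ∀ z, (A z).Nonempty) {g : K → ℝ} (hg : Continuous g) :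
    Measurable fun z => sInf (g '' A z) := by
  refine measurable_of_Iic fun t => ?_
  convert (hA.inter (g := fun _ m => g m - t) (fun _ => measurable_const)
    (fun _ => by fun_prop)).measurableSet_nonempty using 1
  ext z
  simp only [Set.mem_preimage, Set.mem_Iic, Set.mem_ofPred_eq, sub_nonpos]
  constructor
  · intro h
    obtain ⟨m, hm, hmin⟩ := hA.exists_isMinOn (hne z) hg
    exact ⟨m, hm, by simpa [hmin] using h⟩
  · rintro ⟨m, hm, hle⟩
    exact (csInf_le ((hA.isClosed z).isCompact.image hg).bddBelow ⟨m, hm, rfl⟩).trans hle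

/-- Measurable selection: successive minimization along a countable family of continuous
functions. -/
theorem exists_measurable_selection [TopologicalSpace.SeparableSpace K]
    (hA : IsCaratheodorySublevel A) (hne : ∀ z, (A z).Nonempty) (g : ℕ → K → ℝ)
    (hg : ∀ n, Continuous (g n)) :
    ∃ s : Z → K, (∀ z, s z ∈ A z) ∧ ∀ n, Measurable fun z => g n (s z) := by
  let B : ℕ → Z → Set K := fun n => n.rec A fun n B z =>
    B z ∩ {m | g n m - sInf (g n '' B z) ≤ 0}
  have hB : ∀ n, IsCaratheodorySublevel (B n) ∧ ∀ z, (B n z).Nonempty := by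
    intro n
    induction n with
    | zero => exact ⟨hA, hne⟩
    | succ n ih =>
      refine ⟨ih.1.inter (fun m => measurable_const.sub (ih.1.measurable_sInf ih.2 (hg n)))
        (fun z => (hg n).sub continuous_const), fun z => ?_⟩
      obtain ⟨m, hm, hmin⟩ := ih.1.exists_isMinOn (ih.2 z) (hg n)
      exact ⟨m, hm, sub_nonpos.2 hmin.le⟩
  have hinter : ∀ z, (⋂ n, B n z).Nonempty := fun z =>
    IsCompact.nonempty_iInter_of_sequence_nonempty_isCompact_isClosed (fun n => B n z)
      (fun n => Set.inter_subset_left) (fun n => (hB n).2 z) ((hB 0).1.isClosed z).isCompact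
      fun n => (hB n).1.isClosed z
  choose s hs using hinter
  simp only [Set.mem_iInter] at hs
  refine ⟨s, fun z => hs z 0, fun n => ?_⟩
  convert (hB n).1.measurable_sInf (hB n).2 (hg n) using 2 with z
  refine le_antisymm (sub_nonpos.1 (hs z (n + 1)).2) ?_
  exact csInf_le (((hB n).1.isClosed z).isCompact.image (hg n)).bddBelow ⟨_, hs z n, rfl⟩

end Selection

end IsCaratheodorySublevel

namespace InformationTheory

open Filter Topology Real

variable {Y : Type*} [MeasurableSpace Y]

/-- The functional appearing in the dual representation of the Kullback–Leibler divergence of two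
probability measures. -/
noncomputable def klDual (μ ν : Measure Y) (φ : Y → ℝ) : ℝ :=
  ∫ y, φ y ∂μ - ∫ y, (exp (φ y) - 1) ∂ν

lemma mul_sub_exp_le_klFun {x : ℝ} (hx : 0 ≤ x) (t : ℝ) : x * t - (exp t - 1) ≤ klFun x := by
  rcases hx.eq_or_lt with rfl | hx
  · simp [klFun_zero, (exp_pos t).le]
  · have h := add_one_le_exp (t - log x)
    rw [exp_sub, exp_log hx, le_div_iff₀ hx] at h
    rw [klFun_apply]
    linarith

lemma integrable_of_bound {μ : Measure Y} [IsFiniteMeasure μ] {φ : Y → ℝ} (hφ : Measurable φ)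
    {M : ℝ} (hM : ∀ y, |φ y| ≤ M) : Integrable φ μ :=
  .of_bound hφ.aestronglyMeasurable M (ae_of_all _ hM)

lemma abs_exp_sub_one_le {t M : ℝ} (h : |t| ≤ M) : |exp t - 1| ≤ exp M + 1 := by
  have := exp_le_exp.2 ((le_abs_self t).trans h)
  rw [abs_le]
  constructor <;> linarith [exp_pos t]

lemma klDual_le_of_klDiv_le {μ ν : Measure Y} [IsProbabilityMeasure μ] [IsProbabilityMeasure ν]
    {c : ℝ} (hc : 0 ≤ c) (h : klDiv μ ν ≤ ENNReal.ofReal c) {φ : Y → ℝ} (hφ : Measurable φ) {M : ℝ}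
    (hM : ∀ y, |φ y| ≤ M) : klDual μ ν φ ≤ c := by
  obtain ⟨hac, hint⟩ := klDiv_ne_top_iff.1 (h.trans_lt ENNReal.ofReal_lt_top).ne
  have h1 : ∫ y, klFun (μ.rnDeriv ν y).toReal ∂ν ≤ c := by
    rw [← toReal_klDiv_eq_integral_klFun hac]
    exact ENNReal.toReal_le_of_le_ofReal hc h
  refine le_trans ?_ h1
  have h2 : Integrable (fun y => exp (φ y) - 1) ν :=
    integrable_of_bound (by fun_prop) fun y => abs_exp_sub_one_le (hM y)
  have h3 : Integrable (fun y => (μ.rnDeriv ν y).toReal * φ y) ν :=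
    (integrable_rnDeriv_smul_iff hac).2 (integrable_of_bound hφ hM)
  rw [klDual, ← integral_rnDeriv_smul hac]
  simp only [smul_eq_mul]
  rw [← integral_sub h3 h2]
  exact integral_mono (h3.sub h2) ((integrable_klFun_rnDeriv_iff hac).2 hint)
    fun y => mul_sub_exp_le_klFun ENNReal.toReal_nonneg _

lemma absolutelyContinuous_of_klDual_le {μ ν : Measure Y} [IsProbabilityMeasure μ]
    [IsProbabilityMeasure ν] {c : ℝ}
    (h : ∀ φ : Y → ℝ, Measurable φ → (∃ M, ∀ y, |φ y| ≤ M) → klDual μ ν φ ≤ c) : μ ≪ ν := by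
  refine Measure.AbsolutelyContinuous.mk fun s hs hνs => ?_
  by_contra hne
  have hpos : 0 < μ.real s := ENNReal.toReal_pos hne (measure_ne_top _ _)
  have key : ∀ n : ℕ, n * μ.real s ≤ c := by
    intro n
    have := h (s.indicator fun _ => (n : ℝ)) (measurable_const.indicator hs)
      ⟨n, fun y => by by_cases hy : y ∈ s <;> simp [hy]⟩
    rw [klDual, integral_indicator_const _ hs] at this
    have h0 : ∫ y, (exp (s.indicator (fun _ => (n : ℝ)) y) - 1) ∂ν = 0 := by
      refine integral_eq_zero_of_ae ?_
      filter_upwards [measure_eq_zero_iff_ae_notMem.1 hνs] with y hy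
      simp [hy]
    rw [h0, sub_zero, smul_eq_mul, mul_comm] at this
    exact this
  obtain ⟨n, hn⟩ := exists_nat_gt (c / μ.real s)
  exact absurd (key n) (not_le.2 ((div_lt_iff₀ hpos).1 hn))

/-- Truncation of a nonnegative number to `[exp (-n), exp n]`. -/
noncomputable def expClip (n : ℕ) (x : ℝ) : ℝ := max (exp (-n)) (min (exp n) x)

lemma expClip_pos (n : ℕ) (x : ℝ) : 0 < expClip n x := lt_max_of_lt_left (exp_pos _)

lemma abs_log_expClip_le (n : ℕ) (x : ℝ) : |log (expClip n x)| ≤ n := by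
  have h0 := expClip_pos n x
  refine abs_le.2 ⟨(le_log_iff_exp_le h0).2 (le_max_left _ _),
    (log_le_iff_le_exp h0).2 (max_le (exp_le_exp.2 ?_) (min_le_left _ _))⟩
  linarith [n.cast_nonneg (α := ℝ)]

lemma klFun_expClip_le (n : ℕ) (x : ℝ) :
    klFun (expClip n x) ≤ x * log (expClip n x) - (exp (log (expClip n x)) - 1) := by
  rw [exp_log (expClip_pos n x), klFun_apply]
  suffices 0 ≤ (x - expClip n x) * log (expClip n x) by linarith
  have hn : (0 : ℝ) ≤ n := n.cast_nonneg
  unfold expClip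
  rcases le_total x (exp n) with h1 | h1
  · rw [min_eq_right h1]
    rcases le_total x (exp (-n)) with h2 | h2
    · rw [max_eq_left h2, log_exp]
      exact mul_nonneg_of_nonpos_of_nonpos (by linarith) (by linarith)
    · rw [max_eq_right h2]; simp
  · rw [min_eq_left h1, max_eq_right (exp_le_exp.2 (by linarith)), log_exp]
    exact mul_nonneg (by linarith) hn

lemma tendsto_expClip {x : ℝ} (hx : 0 ≤ x) : Tendsto (fun n => expClip n x) atTop (𝓝 x) := by
  have h1 : Tendsto (fun n : ℕ => exp (-(n : ℝ))) atTop (𝓝 0) :=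
    tendsto_exp_neg_atTop_nhds_zero.comp tendsto_natCast_atTop_atTop
  have h2 : Tendsto (fun n : ℕ => min (exp (n : ℝ)) x) atTop (𝓝 x) := by
    refine tendsto_const_nhds.congr' ?_
    filter_upwards [(tendsto_exp_atTop.comp tendsto_natCast_atTop_atTop).eventually_ge_atTop x]
      with n hn using (min_eq_right hn).symm
  simpa only [expClip, max_eq_right hx] using h1.max h2

lemma klDiv_le_of_klDual_le {μ ν : Measure Y} [IsProbabilityMeasure μ] [IsProbabilityMeasure ν]
    {c : ℝ} (h : ∀ φ : Y → ℝ, Measurable φ → (∃ M, ∀ y, |φ y| ≤ M) → klDual μ ν φ ≤ c) :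
    klDiv μ ν ≤ ENNReal.ofReal c := by
  have hac := absolutelyContinuous_of_klDual_le h
  rw [klDiv_eq_lintegral_klFun_of_ac hac]
  set f : Y → ℝ := fun y => (μ.rnDeriv ν y).toReal
  have hf : Measurable f := (μ.measurable_rnDeriv ν).ennreal_toReal
  have hclip : ∀ n, Measurable fun y => expClip n (f y) := fun n => by unfold expClip; fun_prop
  have hbound : ∀ n : ℕ, ∫⁻ y, ENNReal.ofReal (klFun (expClip n (f y))) ∂ν ≤ ENNReal.ofReal c := by
    intro n
    have hφ : Measurable fun y => log (expClip n (f y)) := (hclip n).log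
    have hM : ∀ y, |log (expClip n (f y))| ≤ n := fun y => abs_log_expClip_le n _
    have h2 : Integrable (fun y => exp (log (expClip n (f y))) - 1) ν :=
      integrable_of_bound (by fun_prop) fun y => abs_exp_sub_one_le (hM y)
    have h3 : Integrable (fun y => f y * log (expClip n (f y))) ν :=
      (integrable_rnDeriv_smul_iff hac).2 (integrable_of_bound hφ hM)
    have hle := h _ hφ ⟨n, hM⟩
    rw [klDual, ← integral_rnDeriv_smul hac] at hle
    simp only [smul_eq_mul] at hle
    rw [← integral_sub h3 h2] at hle
    calc _ ≤ ∫⁻ y, ENNReal.ofReal (f y * log (expClip n (f y)) -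
            (exp (log (expClip n (f y))) - 1)) ∂ν :=
          lintegral_mono fun y => ENNReal.ofReal_le_ofReal (klFun_expClip_le n _)
      _ = ENNReal.ofReal (∫ y, f y * log (expClip n (f y)) -
            (exp (log (expClip n (f y))) - 1) ∂ν) := by
          exact (ofReal_integral_eq_lintegral_ofReal (h3.sub h2) (ae_of_all _ fun y =>
            (klFun_nonneg (expClip_pos n (f y)).le).trans (klFun_expClip_le n _))).symm
      _ ≤ _ := ENNReal.ofReal_le_ofReal hle
  calc _ = ∫⁻ y, liminf (fun n => ENNReal.ofReal (klFun (expClip n (f y)))) atTop ∂ν := by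
        refine lintegral_congr fun y => (Tendsto.liminf_eq ?_).symm
        exact ENNReal.tendsto_ofReal ((continuous_klFun.tendsto _).comp
          (tendsto_expClip ENNReal.toReal_nonneg))
    _ ≤ liminf (fun n => ∫⁻ y, ENNReal.ofReal (klFun (expClip n (f y))) ∂ν) atTop :=
        lintegral_liminf_le fun n => (measurable_klFun.comp (hclip n)).ennreal_ofReal
    _ ≤ _ := liminf_le_of_le (by isBoundedDefault) fun b hb => by
        obtain ⟨n, hn⟩ := hb.exists
        exact hn.trans (hbound n)

section Continuous

variable [TopologicalSpace Y] [CompactSpace Y] [BorelSpace Y]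

lemma continuous_integral_continuousMap (μ : Measure Y) [IsFiniteMeasure μ] :
    Continuous fun φ : C(Y, ℝ) => ∫ y, φ y ∂μ := by
  have hint : ∀ φ : C(Y, ℝ), Integrable φ μ := fun φ =>
    integrable_of_bound φ.continuous.measurable φ.norm_coe_le_norm
  refine (LipschitzWith.of_dist_le_mul (K := (μ.real Set.univ).toNNReal) fun φ ψ => ?_).continuous
  rw [dist_eq_norm, ← integral_sub (hint φ) (hint ψ), Real.coe_toNNReal _ measureReal_nonneg,
    mul_comm]
  exact norm_integral_le_of_norm_le_const (ae_of_all _ fun y => by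
    rw [← dist_eq_norm]; exact ContinuousMap.dist_apply_le_dist y)

lemma continuous_klDual (μ ν : Measure Y) [IsFiniteMeasure μ] [IsFiniteMeasure ν] :
    Continuous fun φ : C(Y, ℝ) => klDual μ ν φ := by
  have hexp : Continuous fun t : ℝ => exp t - 1 := by fun_prop
  exact (continuous_integral_continuousMap μ).sub ((continuous_integral_continuousMap ν).comp
    (ContinuousMap.continuous_postcomp ⟨_, hexp⟩))

variable [TopologicalSpace.PseudoMetrizableSpace Y]

lemma klDual_le_of_forall_continuousMap {μ ν : Measure Y} [IsProbabilityMeasure μ]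
    [IsProbabilityMeasure ν] {c : ℝ} (h : ∀ φ : C(Y, ℝ), klDual μ ν φ ≤ c)
    {φ : Y → ℝ} (hφ : Measurable φ) {M : ℝ} (hM : ∀ y, |φ y| ≤ M) : klDual μ ν φ ≤ c := by
  let := TopologicalSpace.pseudoMetrizableSpacePseudoMetric Y
  have hmem : MemLp φ 1 (μ + ν) := memLp_one_iff_integrable.2 (integrable_of_bound hφ hM)
  choose g hg hgm using fun n : ℕ => hmem.exists_boundedContinuous_eLpNorm_sub_le
    ENNReal.one_ne_top (ε := ((n : ℝ≥0∞) + 1)⁻¹) (by simp)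
  have hlim : Tendsto (fun n => eLpNorm (⇑(g n) - φ) 1 (μ + ν)) atTop (𝓝 0) := by
    refine tendsto_of_tendsto_of_tendsto_of_le_of_le tendsto_const_nhds
      (h := fun n : ℕ => ((n : ℝ≥0∞) + 1)⁻¹) ?_ (fun _ => zero_le) fun n => ?_
    · simpa using (tendsto_add_atTop_iff_nat 1).2 ENNReal.tendsto_inv_nat_nhds_zero
    · dsimp only
      rw [eLpNorm_sub_comm]
      exact hg n
  obtain ⟨ns, -, hns⟩ := (tendstoInMeasure_of_tendsto_eLpNorm one_ne_zero
    (fun n => (hgm n).1) hmem.1 hlim).exists_seq_tendsto_ae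
  let ψ : ℕ → C(Y, ℝ) := fun i => ⟨fun y => max (-M) (min M (g (ns i) y)), by fun_prop⟩
  have hψM : ∀ i y, |ψ i y| ≤ M := fun i y => by
    have h0 : 0 ≤ M := (abs_nonneg _).trans (hM y)
    exact abs_le.2 ⟨le_max_left _ _, max_le (by linarith) (min_le_left _ _)⟩
  have hψ : ∀ᵐ y ∂(μ + ν), Tendsto (fun i => ψ i y) atTop (𝓝 (φ y)) := by
    filter_upwards [hns] with y hy
    have := (tendsto_const_nhds (x := -M)).max ((tendsto_const_nhds (x := M)).min hy)
    rwa [min_eq_right (abs_le.1 (hM y)).2, max_eq_right (abs_le.1 (hM y)).1] at this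
  rw [ae_add_measure_iff] at hψ
  have h1 : Tendsto (fun i => ∫ y, ψ i y ∂μ) atTop (𝓝 (∫ y, φ y ∂μ)) :=
    tendsto_integral_of_dominated_convergence (fun _ => M)
      (fun i => (ψ i).continuous.aestronglyMeasurable) (integrable_const _)
      (fun i => ae_of_all _ (hψM i)) hψ.1
  have h2 : Tendsto (fun i => ∫ y, (exp (ψ i y) - 1) ∂ν) atTop
      (𝓝 (∫ y, (exp (φ y) - 1) ∂ν)) :=
    tendsto_integral_of_dominated_convergence (fun _ => exp M + 1)
      (fun i => ((continuous_exp.comp (ψ i).continuous).sub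
        continuous_const).aestronglyMeasurable) (integrable_const _)
      (fun i => ae_of_all _ fun y => abs_exp_sub_one_le (hψM i y)) (by
        filter_upwards [hψ.2] with y hy
        exact ((continuous_exp.tendsto _).comp hy).sub_const 1)
  exact le_of_tendsto' (h1.sub h2) fun i => h (ψ i)

/-- Dual characterization of the sublevel sets of the Kullback–Leibler divergence on a compact
space, tested against a dense sequence of continuous functions. -/
theorem klDiv_le_iff_forall_klDual_le {μ ν : Measure Y} [IsProbabilityMeasure μ]
    [IsProbabilityMeasure ν] {φ : ℕ → C(Y, ℝ)} (hφ : DenseRange φ) {c : ℝ} (hc : 0 ≤ c) :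
    klDiv μ ν ≤ ENNReal.ofReal c ↔ ∀ n, klDual μ ν (φ n) ≤ c := by
  refine ⟨fun h n => klDual_le_of_klDiv_le hc h (φ n).continuous.measurable
    (φ n).norm_coe_le_norm, fun h => klDiv_le_of_klDual_le fun ψ hψ ⟨M, hM⟩ =>
      klDual_le_of_forall_continuousMap (fun ξ => ?_) hψ hM⟩
  exact hφ.induction_on ξ (isClosed_le (continuous_klDual μ ν) continuous_const) h

end Continuous

end InformationTheory

namespace InformationTheory

/-- Chain rule for a common first marginal: the divergence of the composition-products is the
average of the conditional divergences. -/
theorem klDiv_compProd_right_eq_lintegral {α β : Type*} [MeasurableSpace α] [MeasurableSpace β]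
    [MeasurableSpace.CountableOrCountablyGenerated α β]
    (μ : Measure α) [IsFiniteMeasure μ] (κ η : Kernel α β) [IsFiniteKernel κ] [IsFiniteKernel η] :
    klDiv (μ ⊗ₘ κ) (μ ⊗ₘ η) = ∫⁻ a, klDiv (κ a) (η a) ∂μ := by
  by_cases h : ∀ᵐ a ∂μ, κ a ≪ η a
  · have hd : Measurable (Function.uncurry (κ.rnDeriv η)) := κ.measurable_rnDeriv η
    have hwd : μ ⊗ₘ κ = (μ ⊗ₘ η).withDensity (fun p => κ.rnDeriv η p.1 p.2) := by
      ext s hs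
      rw [withDensity_apply _ hs, ← lintegral_indicator hs,
        Measure.lintegral_compProd (by exact hd.indicator hs), Measure.compProd_apply hs]
      refine lintegral_congr_ae ?_
      filter_upwards [h] with a ha
      rw [← Kernel.setLIntegral_rnDeriv ha (measurable_prodMk_left hs),
        ← lintegral_indicator (measurable_prodMk_left hs)]
      rfl
    have hrn : (μ ⊗ₘ κ).rnDeriv (μ ⊗ₘ η) =ᵐ[μ ⊗ₘ η] fun p => κ.rnDeriv η p.1 p.2 := by
      rw [hwd]
      exact Measure.rnDeriv_withDensity _ hd
    rw [klDiv_eq_lintegral_klFun_of_ac (Measure.absolutelyContinuous_compProd_right_iff.2 h)]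
    calc _ = ∫⁻ p, ENNReal.ofReal (klFun (κ.rnDeriv η p.1 p.2).toReal) ∂(μ ⊗ₘ η) := by
          refine lintegral_congr_ae ?_
          filter_upwards [hrn] with p hp using by rw [hp]
      _ = ∫⁻ a, ∫⁻ b, ENNReal.ofReal (klFun (κ.rnDeriv η a b).toReal) ∂η a ∂μ := by
          refine Measure.lintegral_compProd ?_
          exact (measurable_klFun.comp hd.ennreal_toReal).ennreal_ofReal
      _ = _ := by
          refine lintegral_congr_ae ?_
          filter_upwards [h] with a ha
          rw [klDiv_eq_lintegral_klFun_of_ac ha]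
          refine lintegral_congr_ae ?_
          filter_upwards [κ.rnDeriv_eq_rnDeriv_measure (η := η) (a := a)] with b hb using by rw [hb]
  · rw [klDiv_of_not_ac (fun hac => h (Measure.absolutelyContinuous_compProd_right_iff.1 hac)),
      eq_comm, ← top_le_iff]
    have hS := Kernel.measurableSet_absolutelyContinuous κ η
    calc (⊤ : ℝ≥0∞) = ⊤ * μ {a | κ a ≪ η a}ᶜ := (ENNReal.top_mul h).symm
      _ = ∫⁻ a, {a | κ a ≪ η a}ᶜ.indicator (fun _ => ⊤) a ∂μ := by
          rw [lintegral_indicator_const hS.compl]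
      _ ≤ _ := by
          refine lintegral_mono fun a => ?_
          by_cases ha : κ a ≪ η a
          · simp [ha]
          · simp [ha, klDiv_of_not_ac]

end InformationTheory

section MeanField

open InformationTheory TopologicalSpace

/-- A family of probability measures on a compact metrizable space is measurable as soon as the
integrals of a dense sequence of continuous functions are. -/
lemma measurable_of_measurable_integral_denseRange {Z X : Type*} [MeasurableSpace Z]
    [TopologicalSpace X] [CompactSpace X] [PseudoMetrizableSpace X] [MeasurableSpace X]
    [BorelSpace X] {φ : ℕ → C(X, ℝ)} (hφ : DenseRange φ) (s : Z → ProbabilityMeasure X)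
    (hs : ∀ n, Measurable fun z => ∫ x, φ n x ∂(s z : Measure X)) :
    Measurable fun z => (s z : Measure X) := by
  have hall : ∀ ψ : C(X, ℝ), Measurable fun z => ∫ x, ψ x ∂(s z : Measure X) := fun ψ => by
    obtain ⟨u, hu, hlim⟩ := mem_closure_iff_seq_limit.1 (hφ ψ)
    choose i hi using hu
    refine measurable_of_tendsto_metrizable (f := fun n z => ∫ x, u n x ∂(s z : Measure X))
      (fun n => by simpa only [hi] using hs (i n)) (tendsto_pi_nhds.2 fun z => ?_)
    exact ((continuous_integral_continuousMap (s z : Measure X)).tendsto ψ).comp hlim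
  refine Measurable.measure_of_isPiSystem_of_isProbabilityMeasure
    (BorelSpace.measurable_eq.trans borel_eq_generateFrom_isClosed) isPiSystem_isClosed
    fun F hF => ?_
  refine measurable_of_tendsto_metrizable
    (f := fun n z => ∫⁻ x, hF.apprSeq n x ∂(s z : Measure X)) (fun n => ?_)
    (tendsto_pi_nhds.2 fun z => HasOuterApproxClosed.tendsto_lintegral_apprSeq hF _)
  have hc : Continuous fun x => (hF.apprSeq n x : ℝ) :=
    NNReal.continuous_coe.comp (hF.apprSeq n).continuous
  convert (hall ⟨_, hc⟩).ennreal_ofReal using 2 with z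
  rw [ContinuousMap.coe_mk, ofReal_integral_eq_lintegral_ofReal]
  · simp
  · exact integrable_of_bound hc.measurable (M := 1) fun x => by
      simpa using HasOuterApproxClosed.apprSeq_apply_le_one hF n x
  · exact Filter.Eventually.of_forall fun x => NNReal.coe_nonneg _

/-- Mean-field minimizers can be chosen measurably in the target. -/
theorem exists_kernel_isMinOn_klDiv_of_compact {Z X : Type*} [MeasurableSpace Z]
    [TopologicalSpace X] [CompactSpace X] [MetrizableSpace X] [MeasurableSpace X] [BorelSpace X]
    [Nonempty X] {ι : Type*} [Fintype ι] [Nonempty ι] (τ : Kernel Z (ι → X)) [IsMarkovKernel τ] :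
    ∃ κ : ι → Kernel Z X, (∀ i, IsMarkovKernel (κ i)) ∧
      ∀ z (m : ι → ProbabilityMeasure X),
        klDiv (Measure.pi fun i => κ i z) (τ z) ≤ klDiv (Measure.pi fun i => (m i : Measure X)) (τ z) := by
  obtain ⟨φ, hφ⟩ := exists_dense_seq C(ι → X, ℝ)
  obtain ⟨ψ, hψ⟩ := exists_dense_seq C(X, ℝ)
  let K := ι → ProbabilityMeasure X
  let P : K → Measure (ι → X) := fun m => Measure.pi fun i => (m i : Measure X)
  have hP : ∀ m, IsProbabilityMeasure (P m) := fun m => by dsimp only [P]; infer_instance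
  have : Nonempty (ProbabilityMeasure X) :=
    ⟨⟨Measure.dirac (Classical.arbitrary X), inferInstance⟩⟩
  let F : ℕ → Z → K → ℝ := fun n z m => klDual (P m) (τ z) (φ n)
  have hFm : ∀ n m, Measurable fun z => F n z m := fun n m => by
    refine measurable_const.sub ?_
    have : StronglyMeasurable fun y : ι → X => Real.exp (φ n y) - 1 :=
      (by fun_prop : Continuous fun y : ι → X => Real.exp (φ n y) - 1).stronglyMeasurable
    exact this.integral_kernel.measurable
  have hFc : ∀ n z, Continuous (F n z) := fun n z => by
    refine Continuous.sub ?_ continuous_const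
    exact (ProbabilityMeasure.continuous_integral_boundedContinuousFunction
      (BoundedContinuousFunction.mkOfCompact (φ n))).comp ProbabilityMeasure.continuous_pi
  have hiff : ∀ z m (c : ℝ), 0 ≤ c →
      (klDiv (P m) (τ z) ≤ ENNReal.ofReal c ↔ ∀ n, F n z m - c ≤ 0) := fun z m c hc => by
    simp only [sub_nonpos]
    exact klDiv_le_iff_forall_klDual_le hφ hc
  have : SeparableSpace K := by
    let := pseudoMetrizableSpacePseudoMetric K
    infer_instance
  let H : Z → ℝ≥0∞ := fun z => ⨅ m : K, klDiv (P m) (τ z)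
  have hH : Measurable H := by
    refine measurable_of_Iio fun t => ?_
    have : H ⁻¹' Set.Iio t = ⋃ q : ℚ, ⋃ _ : 0 ≤ q ∧ ENNReal.ofReal q < t,
        {z | ({m | ∀ n, F n z m - q ≤ 0} : Set K).Nonempty} := by
      ext z
      simp only [H, Set.mem_preimage, Set.mem_Iio, iInf_lt_iff, Set.mem_iUnion, exists_prop,
        Set.mem_ofPred_eq]
      constructor
      · rintro ⟨m, hm⟩
        obtain ⟨q, hq0, hq1, hq2⟩ := ENNReal.lt_iff_exists_rat_btwn.1 hm
        exact ⟨q, ⟨hq0, hq2⟩, m, (hiff z m q (by exact_mod_cast hq0)).1 hq1.le⟩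
      · rintro ⟨q, ⟨hq0, hq⟩, m, hm⟩
        exact ⟨m, ((hiff z m q (by exact_mod_cast hq0)).2 hm).trans_lt hq⟩
    rw [this]
    refine .iUnion fun q => .iUnion fun _ => ?_
    exact IsCaratheodorySublevel.measurableSet_nonempty ⟨fun n z m => F n z m - q,
      fun n m => (hFm n m).sub_const _, fun n z => (hFc n z).sub continuous_const, fun _ => rfl⟩
  have hlsc : ∀ z, LowerSemicontinuous fun m : K => klDiv (P m) (τ z) := fun z => by
    refine lowerSemicontinuous_iff_isClosed_preimage.2 fun t => ?_
    induction t with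
    | top => simp
    | coe t =>
      have : (fun m : K => klDiv (P m) (τ z)) ⁻¹' Set.Iic (t : ℝ≥0∞) =
          ⋂ n, {m | F n z m - t ≤ 0} := by
        ext m
        simpa using! hiff z m t t.2
      rw [this]
      exact isClosed_iInter fun n =>
        isClosed_le ((hFc n z).sub continuous_const) continuous_const
  let A : Z → Set K := fun z => {m | ∀ n, (if H z = ⊤ then 0 else F n z m - (H z).toReal) ≤ 0}
  have hA : IsCaratheodorySublevel A := by
    refine ⟨fun n z m => if H z = ⊤ then 0 else F n z m - (H z).toReal, fun n m => ?_,
      fun n z => ?_, fun _ => rfl⟩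
    · exact Measurable.ite (hH (measurableSet_singleton ⊤)) measurable_const
        ((hFm n m).sub hH.ennreal_toReal)
    · dsimp only
      split_ifs
      exacts [continuous_const, (hFc n z).sub continuous_const]
  have hAle : ∀ z m, m ∈ A z ↔ klDiv (P m) (τ z) ≤ H z := fun z m => by
    by_cases hz : H z = ⊤
    · simp [A, hz]
    · have := hiff z m (H z).toReal ENNReal.toReal_nonneg
      rw [ENNReal.ofReal_toReal hz] at this
      simp [A, hz, this]
  have hne : ∀ z, (A z).Nonempty := fun z => by
    obtain ⟨m, -, hm⟩ := ((hlsc z).lowerSemicontinuousOn Set.univ).exists_isMinOn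
      Set.univ_nonempty isCompact_univ
    exact ⟨m, (hAle z m).2 (le_iInf fun m' => hm (Set.mem_univ m'))⟩
  obtain ⟨e, he⟩ := exists_surjective_nat (ι × ℕ)
  obtain ⟨s, hsA, hs⟩ := hA.exists_measurable_selection hne
    (fun n m => ∫ x, ψ (e n).2 x ∂(m (e n).1 : Measure X)) fun n =>
      (ProbabilityMeasure.continuous_integral_boundedContinuousFunction
        (BoundedContinuousFunction.mkOfCompact (ψ (e n).2))).comp (continuous_apply (e n).1)
  have hsm : ∀ i, Measurable fun z => (s z i : Measure X) := fun i =>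
    measurable_of_measurable_integral_denseRange hψ (fun z => s z i) fun n => by
      obtain ⟨p, hp⟩ := he (i, n)
      simpa [hp] using hs p
  exact ⟨fun i => ⟨_, hsm i⟩, fun i => ⟨fun z => (s z i).2⟩,
    fun z m => ((hAle z _).1 (hsA z)).trans (iInf_le _ m)⟩

/-- Mean-field minimizers on real coordinates can be chosen measurably in the target. -/
theorem exists_kernel_isMinOn_klDiv {Z : Type*} [MeasurableSpace Z]
    {ι : Type*} [Fintype ι] [Nonempty ι] (τ : Kernel Z (ι → ℝ)) [IsMarkovKernel τ] :
    ∃ κ : ι → Kernel Z ℝ, (∀ i, IsMarkovKernel (κ i)) ∧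
      ∀ z (m : ι → Measure ℝ), (∀ i, IsProbabilityMeasure (m i)) →
        klDiv (Measure.pi fun i => κ i z) (τ z) ≤ klDiv (Measure.pi m) (τ z) := by
  have hI : ¬ Countable unitInterval := fun h =>
    absurd (Cardinal.Real.Icc_countable_iff.1 (Set.countable_coe_iff.1 h)) (by norm_num)
  let e : ℝ ≃ᵐ unitInterval := PolishSpace.measurableEquivOfNotCountable not_countable hI
  let E : (ι → ℝ) ≃ᵐ (ι → unitInterval) := MeasurableEquiv.piCongrRight fun _ => e
  have : IsMarkovKernel (τ.map E) := Kernel.IsMarkovKernel.map τ E.measurable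
  obtain ⟨κ, hκ, hmin⟩ := exists_kernel_isMinOn_klDiv_of_compact (τ.map E)
  refine ⟨fun i => (κ i).map e.symm, fun i => Kernel.IsMarkovKernel.map _ e.symm.measurable,
    fun z m hm => ?_⟩
  have hpi : (Measure.pi fun i => κ i z).map E.symm =
      Measure.pi fun i => (κ i).map e.symm z := by
    simp_rw [Kernel.map_apply _ e.symm.measurable]
    exact Measure.pi_map_pi fun i => e.symm.measurable.aemeasurable
  have hpi' : (Measure.pi m).map E = Measure.pi fun i => (m i).map e :=
    Measure.pi_map_pi fun i => e.measurable.aemeasurable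
  have hτ : ((τ.map E) z).map E.symm = τ z := by
    rw [Kernel.map_apply _ E.measurable, Measure.map_map E.symm.measurable E.measurable]
    simp
  have hme : ∀ i, IsProbabilityMeasure ((m i).map e) := fun i =>
    Measure.isProbabilityMeasure_map e.measurable.aemeasurable
  calc klDiv (Measure.pi fun i => (κ i).map e.symm z) (τ z)
      = klDiv ((Measure.pi fun i => κ i z).map E.symm) (((τ.map E) z).map E.symm) := by
        rw [hpi, hτ]
    _ ≤ klDiv (Measure.pi fun i => κ i z) ((τ.map E) z) := klDiv_map_le _ _ E.symm.measurable
    _ ≤ klDiv (Measure.pi fun i => (m i).map e) ((τ.map E) z) :=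
        hmin z fun i => ⟨(m i).map e, hme i⟩
    _ = klDiv ((Measure.pi m).map E) ((τ z).map E) := by
        rw [hpi', Kernel.map_apply _ E.measurable]
    _ ≤ _ := klDiv_map_le _ _ E.measurable

end MeanField

lemma KL_eq_klDiv {E : Type*} [MeasurableSpace E] (μ π : Measure E) [IsProbabilityMeasure μ]
    [IsProbabilityMeasure π] : KL μ π = InformationTheory.klDiv μ π := by
  rw [KL, InformationTheory.klDiv_def]
  by_cases h : μ ≪ π ∧ Integrable (llr μ π) μ
  · rw [if_pos h]
    refine (if_pos h).trans ?_
    simp [llr_def]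
  · rw [if_neg h]
    exact if_neg h

lemma IsProductProb.isProbabilityMeasure {k : ℕ} {ν : Measure (Fin k → ℝ)}
    (hν : IsProductProb ν) : IsProbabilityMeasure ν := by
  obtain ⟨m, hm, rfl⟩ := hν
  infer_instance

/-- The kernel of product measures associated with a finite family of Markov kernels. -/
noncomputable def piKernel {k : ℕ} (κ : Fin k → Kernel ℝ ℝ) [∀ j, IsMarkovKernel (κ j)] :
    Kernel ℝ (Fin k → ℝ) where
  toFun z := Measure.pi fun j => κ j z
  measurable' := by
    refine Measurable.measure_of_isPiSystem_of_isProbabilityMeasure generateFrom_pi.symm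
      isPiSystem_pi ?_
    rintro _ ⟨s, hs, rfl⟩
    simp only [Measure.pi_pi]
    exact Finset.measurable_prod _ fun j _ => (κ j).measurable_coe (hs j (Set.mem_univ j))

instance {k : ℕ} (κ : Fin k → Kernel ℝ ℝ) [∀ j, IsMarkovKernel (κ j)] :
    IsMarkovKernel (piKernel κ) :=
  ⟨fun z => inferInstanceAs (IsProbabilityMeasure (Measure.pi fun j => κ j z))⟩

lemma starMeasure_eq_compProd {k : ℕ} (μ₁ : Measure ℝ) [IsProbabilityMeasure μ₁]
    (κ : Fin k → Kernel ℝ ℝ) [∀ j, IsMarkovKernel (κ j)] :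
    starMeasure μ₁ κ = μ₁ ⊗ₘ piKernel κ := by
  rw [Measure.compProd_eq_comp_prod]
  unfold starMeasure
  congr 1
  ext1 z
  rw [Kernel.prod_apply, Kernel.id_apply]
  rfl

lemma KL_starMeasure {k : ℕ} (μ₁ π₁ : Measure ℝ) [IsProbabilityMeasure μ₁]
    [IsProbabilityMeasure π₁] (κ : Fin k → Kernel ℝ ℝ) [∀ j, IsMarkovKernel (κ j)]
    (η : Kernel ℝ (Fin k → ℝ)) [IsMarkovKernel η] :
    KL (starMeasure μ₁ κ) (π₁ ⊗ₘ η) =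
      KL μ₁ π₁ + ∫⁻ z, KL (Measure.pi fun j => κ j z) (η z) ∂μ₁ := by
  rw [starMeasure_eq_compProd, KL_eq_klDiv, KL_eq_klDiv,
    InformationTheory.klDiv_compProd_eq_add,
    InformationTheory.klDiv_compProd_right_eq_lintegral]
  simp_rw [KL_eq_klDiv]
  rfl

/-- **Dynamic programming principle for star-structured variational inference.**
Here `d = k + 1 ≥ 2`, the root coordinate is the first factor, `π.fst` is the
first marginal `π₁`, and `πcond z₁` is the conditional `π_{-1}(· ∣ z₁)`. -/
theorem stmt0 {k : ℕ} (hk : 1 ≤ k)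
    (π : Measure (ℝ × (Fin k → ℝ))) [IsProbabilityMeasure π]
    (f : ℝ × (Fin k → ℝ) → ℝ) (hf : Measurable f) (hfpos : ∀ z, 0 < f z)
    (hπf : π = volume.withDensity fun z => ENNReal.ofReal (f z))
    (πcond : Kernel ℝ (Fin k → ℝ)) [IsMarkovKernel πcond]
    (hdis : π = π.fst ⊗ₘ πcond) :
    (⨅ (μ : Measure (ℝ × (Fin k → ℝ))) (_ : IsStar μ), KL μ π) =
      ⨅ (μ₁ : Measure ℝ) (_ : IsProbabilityMeasure μ₁),
        (KL μ₁ π.fst + ∫⁻ z₁, hval (πcond z₁) ∂μ₁) := by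
  have : Nonempty (Fin k) := ⟨⟨0, hk⟩⟩
  have hprod : ∀ κ : Fin k → Kernel ℝ ℝ, (∀ j, IsMarkovKernel (κ j)) → ∀ z,
      IsProductProb (Measure.pi fun j => κ j z) := fun κ hκ z =>
    ⟨fun j => κ j z, fun j => inferInstance, rfl⟩
  apply le_antisymm
  · refine le_iInf₂ fun μ₁ hμ₁ => ?_
    obtain ⟨κ, hκ, hmin⟩ := exists_kernel_isMinOn_klDiv πcond
    have hstar : IsStar (starMeasure μ₁ κ) :=
      ⟨by rw [starMeasure_eq_compProd]; infer_instance, μ₁, κ, hμ₁, hκ, rfl⟩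
    refine (iInf₂_le _ hstar).trans ?_
    conv_lhs => rw [hdis, KL_starMeasure]
    gcongr with z
    refine le_iInf₂ fun ν hν => ?_
    have := hν.isProbabilityMeasure
    rw [KL_eq_klDiv, KL_eq_klDiv]
    obtain ⟨m, hm, rfl⟩ := hν
    exact hmin z m hm
  · refine le_iInf₂ fun μ hμ => ?_
    obtain ⟨-, μ₁, κ, hμ₁, hκ, rfl⟩ := hμ
    refine (iInf₂_le μ₁ hμ₁).trans ?_
    conv_rhs => rw [hdis, KL_starMeasure]
    gcongr with z
    exact iInf₂_le _ (hprod κ hκ z)
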